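/- Let H be a Hopf algebra and γ a 2-cocycle on H. Then for all g, h, k ∈ H the identity γ(g h₍₁₎ ⊗ S(h₍₂₎)k) = γ̄(g₍₁₎ ⊗ h₍₁₎) u_γ(h₍₂₎) γ̄(S(h₍₃₎) ⊗ k₍₁₎) γ(g₍₂₎ ⊗ k₍₂₎) holds. -/

import Mathlib

open TensorProduct LinearMap

noncomputable section

variable (R H : Type*) [CommRing R] [Ring H] [HopfAlgebra R H]

/-- The multiplication of `H` as a linear map. -/
abbrev mulH : H ⊗[R] H →ₗ[R] H := LinearMap.mul' R H

/-- The antipode of `H`. -/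
abbrev Sa : H →ₗ[R] H := HopfAlgebra.antipode (R := R)

/-- The comultiplication `h ⊗ k ↦ (h₍₁₎ ⊗ k₍₁₎) ⊗ (h₍₂₎ ⊗ k₍₂₎)` on `H ⊗ H`. -/
def comul2 : H ⊗[R] H →ₗ[R] (H ⊗[R] H) ⊗[R] (H ⊗[R] H) :=
  (tensorTensorTensorComm R H H H H).toLinearMap ∘ₗ map (Coalgebra.comul (R := R)) (Coalgebra.comul (R := R))

/-- The (Coalgebra.counit (R := R)) `h ⊗ k ↦ ε(h)ε(k)` on `H ⊗ H`. -/
def counit2 : H ⊗[R] H →ₗ[R] R :=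
  (TensorProduct.lid R R).toLinearMap ∘ₗ map (Coalgebra.counit (R := R)) (Coalgebra.counit (R := R))

/-- Iterated comultiplication `h ↦ (h₍₁₎ ⊗ h₍₂₎) ⊗ h₍₃₎`. -/
def comul3 : H →ₗ[R] (H ⊗[R] H) ⊗[R] H := map (Coalgebra.comul (R := R)) LinearMap.id ∘ₗ (Coalgebra.comul (R := R))

/-- Iterated comultiplication `h ↦ ((h₍₁₎ ⊗ h₍₂₎) ⊗ h₍₃₎) ⊗ h₍₄₎`. -/
def comul4 : H →ₗ[R] ((H ⊗[R] H) ⊗[R] H) ⊗[R] H := map (comul3 R H) LinearMap.id ∘ₗ (Coalgebra.comul (R := R))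

/-- Convolution product of two functionals with respect to a given comultiplication. -/
def convOn {C : Type*} [AddCommMonoid C] [Module R C]
    (Δc : C →ₗ[R] C ⊗[R] C) (f g : C →ₗ[R] R) : C →ₗ[R] R :=
  LinearMap.mul' R R ∘ₗ map f g ∘ₗ Δc

/-- The comultiplication on the triple tensor product `(H ⊗ H) ⊗ H`. -/
def comulC3 : (H ⊗[R] H) ⊗[R] H →ₗ[R] ((H ⊗[R] H) ⊗[R] H) ⊗[R] ((H ⊗[R] H) ⊗[R] H) :=
  (tensorTensorTensorComm R (H ⊗[R] H) (H ⊗[R] H) H H).toLinearMap ∘ₗ map (comul2 R H) (Coalgebra.comul (R := R))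

/-- `γ` is a 2-cocycle with convolution inverse `γ'` relative to the product `μ`:
convolution invertible, unital, and satisfying the 2-cocycle condition
`γ(g₍₁₎⊗h₍₁₎)γ(g₍₂₎h₍₂₎⊗k) = γ(h₍₁₎⊗k₍₁₎)γ(g⊗h₍₂₎k₍₂₎)`. -/
structure IsCocycle (μ : H ⊗[R] H →ₗ[R] H) (γ γ' : H ⊗[R] H →ₗ[R] R) : Prop where
  cocycle : convOn R (comulC3 R H) (LinearMap.mul' R R ∘ₗ map γ (Coalgebra.counit (R := R))) (γ ∘ₗ map μ LinearMap.id)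
    = convOn R (comulC3 R H)
        (LinearMap.mul' R R ∘ₗ map (Coalgebra.counit (R := R)) γ ∘ₗ (TensorProduct.assoc R H H H).toLinearMap)
        (γ ∘ₗ map LinearMap.id μ ∘ₗ (TensorProduct.assoc R H H H).toLinearMap)
  conv_inv_right : convOn R (comul2 R H) γ γ' = counit2 R H
  conv_inv_left : convOn R (comul2 R H) γ' γ = counit2 R H
  unital_right : ∀ h : H, γ (h ⊗ₜ[R] 1) = (Coalgebra.counit (R := R)) h
  unital_left : ∀ h : H, γ (1 ⊗ₜ[R] h) = (Coalgebra.counit (R := R)) h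

/-- The twisted product `h ·_γ k = γ(h₍₁₎⊗k₍₁₎) h₍₂₎∙k₍₂₎ γ'(h₍₃₎⊗k₍₃₎)`, where `∙` is
the (possibly already deformed) product `μ`. -/
def twistMul (μ : H ⊗[R] H →ₗ[R] H) (γ γ' : H ⊗[R] H →ₗ[R] R) : H ⊗[R] H →ₗ[R] H :=
  (TensorProduct.lid R H).toLinearMap ∘ₗ (TensorProduct.rid R (R ⊗[R] H)).toLinearMap
    ∘ₗ map (map γ μ) γ' ∘ₗ map (comul2 R H) LinearMap.id ∘ₗ comul2 R H

/-- `u_γ(h) = γ(h₍₁₎ ⊗ S(h₍₂₎))`. -/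
def uMap (γ : H ⊗[R] H →ₗ[R] R) : H →ₗ[R] R :=
  γ ∘ₗ map LinearMap.id (Sa R H) ∘ₗ (Coalgebra.comul (R := R))

/-- `ū_γ(h) = γ'(S(h₍₁₎) ⊗ h₍₂₎)`. -/
def ubarMap (γ' : H ⊗[R] H →ₗ[R] R) : H →ₗ[R] R :=
  γ' ∘ₗ map (Sa R H) LinearMap.id ∘ₗ (Coalgebra.comul (R := R))

/-- The twisted antipode `S_γ(h) = u_γ(h₍₁₎) S(h₍₂₎) ū_γ(h₍₃₎)`. -/
def Stw (γ γ' : H ⊗[R] H →ₗ[R] R) : H →ₗ[R] H :=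
  (TensorProduct.lid R H).toLinearMap ∘ₗ (TensorProduct.rid R (R ⊗[R] H)).toLinearMap
    ∘ₗ map (map (uMap R H γ) (Sa R H)) (ubarMap R H γ') ∘ₗ comul3 R H

/-- The (generalized) right adjoint coaction `h ↦ h₍₂₎ ⊗ S'(h₍₁₎) ∙ h₍₃₎`. -/
def AdGen (S' : H →ₗ[R] H) (μ : H ⊗[R] H →ₗ[R] H) : H →ₗ[R] H ⊗[R] H :=
  map LinearMap.id μ ∘ₗ (TensorProduct.assoc R H H H).toLinearMap
    ∘ₗ map ((TensorProduct.comm R H H).toLinearMap ∘ₗ map S' LinearMap.id) LinearMap.id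
    ∘ₗ comul3 R H

/-- The right adjoint coaction `Ad(h) = h₍₂₎ ⊗ S(h₍₁₎)h₍₃₎`. -/
def Ad : H →ₗ[R] H ⊗[R] H := AdGen R H (Sa R H) (mulH R H)

end

/-- The comultiplication on `H ⊗ (H ⊗ H)`. -/
noncomputable def comulT (R H : Type*) [CommRing R] [Ring H] [HopfAlgebra R H] :
    H ⊗[R] (H ⊗[R] H) →ₗ[R] (H ⊗[R] (H ⊗[R] H)) ⊗[R] (H ⊗[R] (H ⊗[R] H)) :=
  (tensorTensorTensorComm R H H (H ⊗[R] H) (H ⊗[R] H)).toLinearMap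
    ∘ₗ map (Coalgebra.comul (R := R)) (comul2 R H)

namespace HopfAlgebra

open Coalgebra WithConv

section Antipode

variable {R H : Type*} [CommRing R] [Ring H] [HopfAlgebra R H]

theorem comp_antipode_mul_comp {A : Type*} [Ring A] [Algebra R A] (f : H →ₐ[R] A) :
    toConv (f.toLinearMap ∘ₗ antipode R) * toConv f.toLinearMap = 1 := by
  have h := algHom_comp_convMul_distrib f (toConv (antipode R (A := H))) (toConv LinearMap.id)
  rw [LinearMap.antipode_mul_id] at h
  apply WithConv.ofConv_injective
  refine h.symm.trans ?_
  ext x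
  simp

theorem comp_mul_comp_antipode {A : Type*} [Ring A] [Algebra R A] (f : H →ₐ[R] A) :
    toConv f.toLinearMap * toConv (f.toLinearMap ∘ₗ antipode R) = 1 := by
  have h := algHom_comp_convMul_distrib f (toConv LinearMap.id) (toConv (antipode R (A := H)))
  rw [LinearMap.id_mul_antipode] at h
  apply WithConv.ofConv_injective
  refine h.symm.trans ?_
  ext x
  simp

variable (R H) in
/-- The inclusion `h ↦ h ⊗ 1`. -/
abbrev inlH : H →ₗ[R] H ⊗[R] H :=
  (Algebra.TensorProduct.includeLeft : H →ₐ[R] H ⊗[R] H).toLinearMap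

variable (R H) in
/-- The inclusion `h ↦ 1 ⊗ h`. -/
abbrev inrH : H →ₗ[R] H ⊗[R] H :=
  (Algebra.TensorProduct.includeRight : H →ₐ[R] H ⊗[R] H).toLinearMap

theorem toConv_comul_eq :
    toConv (comul (R := R) (A := H)) = toConv (inlH R H) * toConv (inrH R H) := by
  ext x
  rw [(ℛ R x).convMul_apply]
  simp [(ℛ R x).eq]

/-- The antipode reverses the comultiplication, as a convolution identity. -/
theorem toConv_comul_comp_antipode :
    toConv (comul (R := R) (A := H) ∘ₗ antipode R) =
      toConv (inrH R H ∘ₗ antipode R) * toConv (inlH R H ∘ₗ antipode R) := by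
  refine (left_inv_eq_right_inv ?_ (LinearMap.comul_right_inv (R := R) (C := H))).symm
  rw [toConv_comul_eq, mul_assoc, ← mul_assoc (toConv (inlH R H ∘ₗ antipode R)),
    comp_antipode_mul_comp, one_mul, comp_antipode_mul_comp]

theorem comul_antipode (h : H) :
    comul (R := R) (antipode R h) =
      ∑ i ∈ (ℛ R h).index, antipode R ((ℛ R h).right i) ⊗ₜ[R] antipode R ((ℛ R h).left i) := by
  have := congr(($(toConv_comul_comp_antipode (R := R) (H := H))) h)
  rw [(ℛ R h).convMul_apply] at this
  simpa using this

theorem sum_one_tmul_mul_comul_antipode (h : H) :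
    ∑ i ∈ (ℛ R h).index,
      ((1 : H) ⊗ₜ[R] (ℛ R h).left i) * comul (R := R) (antipode R ((ℛ R h).right i)) =
      antipode R h ⊗ₜ[R] 1 := by
  have key : toConv (inrH R H) * toConv (comul (R := R) (A := H) ∘ₗ antipode R) =
      toConv (inlH R H ∘ₗ antipode R) := by
    rw [toConv_comul_comp_antipode, ← mul_assoc, comp_mul_comp_antipode, one_mul]
  have := congr(($key) h)
  rw [(ℛ R h).convMul_apply] at this
  simpa using this

end Antipode

section Coassoc

variable {R H M : Type*} [CommRing R] [Ring H] [HopfAlgebra R H] [AddCommGroup M] [Module R M]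

theorem sum_coassoc (T : H ⊗[R] (H ⊗[R] H) →ₗ[R] M) (h : H) :
    ∑ j ∈ (ℛ R h).index, ∑ p ∈ (ℛ R ((ℛ R h).left j)).index,
        T ((ℛ R ((ℛ R h).left j)).left p ⊗ₜ
          ((ℛ R ((ℛ R h).left j)).right p ⊗ₜ (ℛ R h).right j)) =
      ∑ j ∈ (ℛ R h).index, ∑ p ∈ (ℛ R ((ℛ R h).right j)).index,
        T ((ℛ R h).left j ⊗ₜ
          ((ℛ R ((ℛ R h).right j)).left p ⊗ₜ (ℛ R ((ℛ R h).right j)).right p)) := by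
  simpa using congr(T $(sum_tmul_tmul_eq (ℛ R h) (fun j => ℛ R ((ℛ R h).left j))
    (fun j => ℛ R ((ℛ R h).right j))))

theorem sum_counit_mul (f : H →ₗ[R] R) (h : H) :
    ∑ j ∈ (ℛ R h).index, counit (R := R) ((ℛ R h).left j) * f ((ℛ R h).right j) = f h := by
  simpa using congr(f $(sum_counit_smul (ℛ R h)))

theorem sum_mul_counit (f : H →ₗ[R] R) (h : H) :
    ∑ j ∈ (ℛ R h).index, f ((ℛ R h).left j) * counit (R := R) ((ℛ R h).right j) = f h := by
  have := congr(TensorProduct.rid R R $(sum_map_tmul_counit_eq f h (repr := ℛ R h)))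
  simpa only [map_sum, TensorProduct.rid_tmul, smul_eq_mul, one_mul, mul_comm] using this

end Coassoc

section Translation

variable (R : Type*) {H : Type*} [CommRing R] [Ring H] [HopfAlgebra R H]

/-- The translation map `h ↦ h₍₁₎ ⊗ S(h₍₂₎)`. -/
noncomputable def translation : H →ₗ[R] H ⊗[R] H := map LinearMap.id (antipode R) ∘ₗ comul

variable {R}

theorem translation_apply (h : H) : translation R h =
    ∑ j ∈ (ℛ R h).index, (ℛ R h).left j ⊗ₜ[R] antipode R ((ℛ R h).right j) := by
  conv_lhs => rw [translation, LinearMap.comp_apply, ← (ℛ R h).eq]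
  simp

theorem map_mul_comul_tmul (a l : H) :
    map LinearMap.id (LinearMap.mul' R H) (comul (R := R) (a ⊗ₜ[R] l)) =
      ∑ p ∈ (ℛ R a).index, (TensorProduct.assoc R H H H).symm
        ((ℛ R a).left p ⊗ₜ (((1 : H) ⊗ₜ[R] (ℛ R a).right p) * comul (R := R) l)) := by
  rw [← ((ℛ R a).tmul (ℛ R l)).eq]
  conv_rhs => rw [← (ℛ R l).eq]
  simp [Finset.sum_product, Finset.mul_sum, tmul_sum]

/-- `h₍₁₎ ⊗ S(h₍₂₎)` is coinvariant for the diagonal coaction of `H` on `H ⊗ H`. -/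
theorem map_mul_comul_translation (h : H) :
    map LinearMap.id (LinearMap.mul' R H) (comul (R := R) (translation R h)) =
      translation R h ⊗ₜ[R] 1 := by
  have key := sum_coassoc ((TensorProduct.assoc R H H H).symm.toLinearMap ∘ₗ
    lTensor H (LinearMap.mul' R (H ⊗[R] H) ∘ₗ map (inrH R H) (comul ∘ₗ antipode R))) h
  simp only [LinearMap.comp_apply, lTensor_tmul, map_tmul, LinearMap.mul'_apply,
    LinearEquiv.coe_coe, AlgHom.toLinearMap_apply,
    Algebra.TensorProduct.includeRight_apply] at key
  simp only [translation_apply, map_sum, map_mul_comul_tmul, key, sum_tmul]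
  refine Finset.sum_congr rfl fun j _ => ?_
  rw [← map_sum, ← tmul_sum, sum_one_tmul_mul_comul_antipode]
  simp

theorem convMul_comp_mul_translation (f : H ⊗[R] H →ₗ[R] R) (t : H →ₗ[R] R) (h : H) :
    (toConv f * toConv (t ∘ₗ LinearMap.mul' R H)) (translation R h) =
      f (translation R h) * t 1 := by
  have := congr(LinearMap.mul' R R (map f t $(map_mul_comul_translation (R := R) h)))
  rw [map_tmul, LinearMap.mul'_apply] at this
  rw [← this, LinearMap.convMul_apply, ← LinearMap.comp_apply (map f t), ← map_comp]
  simp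

end Translation

section Cocycle

variable {R H : Type*} [CommRing R] [Ring H] [HopfAlgebra R H]
  {γ γ' : H ⊗[R] H →ₗ[R] R}

theorem _root_.IsCocycle.inv_mul (hco : IsCocycle R H (mulH R H) γ γ') :
    toConv γ' * toConv γ = 1 := by
  apply WithConv.ofConv_injective
  refine Eq.trans ?_ (hco.conv_inv_left.trans ?_)
  · rfl
  · ext; simp [counit2, LinearMap.convOne_def, mul_comm]

theorem _root_.IsCocycle.convMul_tmul (hco : IsCocycle R H (mulH R H) γ γ') (g h k : H) :
    (toConv γ * toConv ((γ ∘ₗ (TensorProduct.mk R H H).flip k) ∘ₗ LinearMap.mul' R H)) (g ⊗ₜ h) =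
      (toConv γ * toConv ((γ ∘ₗ TensorProduct.mk R H H g) ∘ₗ LinearMap.mul' R H)) (h ⊗ₜ k) := by
  have key := congr($(hco.cocycle) ((g ⊗ₜ h) ⊗ₜ k))
  have e : comulC3 R H = comul := rfl
  simp only [convOn, e, LinearMap.comp_apply,
    ← (((ℛ R g).tmul (ℛ R h)).tmul (ℛ R k)).eq] at key
  rw [((ℛ R g).tmul (ℛ R h)).convMul_apply, ((ℛ R h).tmul (ℛ R k)).convMul_apply]
  have hk (a : H) := sum_counit_mul (γ ∘ₗ TensorProduct.mk R H H a) k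
  have hg (c : H) := sum_counit_mul (γ ∘ₗ (TensorProduct.mk R H H).flip c) g
  simp only [LinearMap.comp_apply, TensorProduct.mk_apply, LinearMap.flip_apply] at hk hg
  simp only [Coalgebra.Repr.tmul_index, Coalgebra.Repr.tmul_left, Coalgebra.Repr.tmul_right,
    Finset.sum_product, map_sum, map_tmul, LinearMap.comp_apply, LinearEquiv.coe_coe,
    TensorProduct.assoc_tmul, LinearMap.mul'_apply, LinearMap.id_apply, mul_assoc,
    ← Finset.mul_sum, hk] at key
  simp only [Coalgebra.Repr.tmul_index, Coalgebra.Repr.tmul_left, Coalgebra.Repr.tmul_right,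
    Finset.sum_product, LinearMap.comp_apply, LinearMap.mul'_apply,
    TensorProduct.mk_apply, LinearMap.flip_apply]
  simp only [key, Finset.mul_sum]
  rw [Finset.sum_comm]
  refine Finset.sum_congr rfl fun j _ => ?_
  rw [Finset.sum_comm]
  refine Finset.sum_congr rfl fun l _ => ?_
  simp only [mul_left_comm _ (γ ((ℛ R h).left j ⊗ₜ[R] (ℛ R k).left l)), ← Finset.mul_sum, hg]

theorem convMul_comp_mul_lTensor_mulRight (f : H ⊗[R] H →ₗ[R] R) (t : H →ₗ[R] R) (k : H)
    (x : H ⊗[R] H) :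
    (toConv f * toConv (t ∘ₗ LinearMap.mul' R H)) ((mulRight R k).lTensor H x) =
      ∑ l ∈ (ℛ R k).index, (toConv (f ∘ₗ (mulRight R ((ℛ R k).left l)).lTensor H) *
        toConv ((t ∘ₗ mulRight R ((ℛ R k).right l)) ∘ₗ LinearMap.mul' R H)) x := by
  induction x with
  | zero => simp
  | add x y hx hy => simp only [map_add, hx, hy, Finset.sum_add_distrib]
  | tmul a b =>
    simp only [lTensor_tmul, mulRight_apply]
    rw [((ℛ R a).tmul ((ℛ R b).mul (ℛ R k))).convMul_apply]
    simp only [((ℛ R a).tmul (ℛ R b)).convMul_apply]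
    rw [Finset.sum_comm]
    simp [Finset.sum_product, mul_assoc]

theorem convMul_comp_mul_lTensor_translation (f : H ⊗[R] H →ₗ[R] R) (t : H →ₗ[R] R) (h k : H) :
    (toConv f * toConv (t ∘ₗ LinearMap.mul' R H))
        ((mulRight R k).lTensor H (translation R h)) =
      ∑ l ∈ (ℛ R k).index, f ((mulRight R ((ℛ R k).left l)).lTensor H (translation R h)) *
        t ((ℛ R k).right l) := by
  rw [convMul_comp_mul_lTensor_mulRight]
  simp only [convMul_comp_mul_translation, LinearMap.comp_apply, mulRight_apply, one_mul]

/-- The representation of `Δ(S(h))` coming from one of `Δ(h)`. -/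
noncomputable def reprAntipode (h : H) : Coalgebra.Repr R (antipode R h) (H × H) where
  index := (ℛ R h).index
  left i := antipode R ((ℛ R h).right i)
  right i := antipode R ((ℛ R h).left i)
  eq := (comul_antipode h).symm

/-- `γ(h₍₁₎ ⊗ S(h₍₂₎)k) = u_γ(h₍₁₎) γ'(S(h₍₂₎) ⊗ k)`. -/
theorem _root_.IsCocycle.lTensor_mulRight_translation (hco : IsCocycle R H (mulH R H) γ γ')
    (h k : H) :
    γ ((mulRight R k).lTensor H (translation R h)) =
      ∑ j ∈ (ℛ R h).index, γ (translation R ((ℛ R h).left j)) *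
        γ' (antipode R ((ℛ R h).right j) ⊗ₜ k) := by
  have expand (a m : H) : γ (a ⊗ₜ (antipode R m * k)) =
      ∑ n ∈ (ℛ R k).index, ∑ q ∈ (ℛ R m).index,
        (toConv γ * toConv ((γ ∘ₗ (TensorProduct.mk R H H).flip ((ℛ R k).right n)) ∘ₗ
          LinearMap.mul' R H)) (a ⊗ₜ antipode R ((ℛ R m).left q)) *
        γ' (antipode R ((ℛ R m).right q) ⊗ₜ (ℛ R k).left n) := by
    have : γ (a ⊗ₜ (antipode R m * k)) =
        (toConv γ' * (toConv γ * toConv ((γ ∘ₗ TensorProduct.mk R H H a) ∘ₗ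
          LinearMap.mul' R H))) (antipode R m ⊗ₜ k) := by
      rw [← mul_assoc, hco.inv_mul, one_mul]
      simp
    rw [this, ((reprAntipode m).tmul (ℛ R k)).convMul_apply]
    simp only [hco.convMul_tmul]
    simp [Finset.sum_product, reprAntipode, -LinearMap.convMul_apply]
    rw [Finset.sum_comm]
    simp only [mul_comm]
  have key (n : H × H) := sum_coassoc (LinearMap.mul' R R ∘ₗ
    map ((toConv γ * toConv ((γ ∘ₗ (TensorProduct.mk R H H).flip ((ℛ R k).right n)) ∘ₗ
          LinearMap.mul' R H)).ofConv ∘ₗ (antipode R).lTensor H)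
      (γ' ∘ₗ (TensorProduct.mk R H H).flip ((ℛ R k).left n) ∘ₗ antipode R) ∘ₗ
    (TensorProduct.assoc R H H H).symm.toLinearMap) h
  simp only [LinearMap.comp_apply, LinearEquiv.coe_coe, TensorProduct.assoc_symm_tmul, map_tmul,
    LinearMap.mul'_apply, lTensor_tmul, LinearMap.flip_apply, TensorProduct.mk_apply] at key
  conv_lhs => rw [translation_apply]
  simp only [map_sum, lTensor_tmul, mulRight_apply, expand]
  rw [Finset.sum_comm]
  simp only [← key, ← Finset.sum_mul, ← map_sum, ← translation_apply]
  simp only [convMul_comp_mul_translation, LinearMap.comp_apply, LinearMap.flip_apply,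
    TensorProduct.mk_apply, hco.unital_left]
  rw [Finset.sum_comm]
  refine Finset.sum_congr rfl fun j _ => ?_
  have := sum_mul_counit (γ' ∘ₗ TensorProduct.mk R H H (antipode R ((ℛ R h).right j))) k
  simp only [LinearMap.comp_apply, TensorProduct.mk_apply] at this
  simp only [mul_assoc, ← Finset.mul_sum, mul_comm (counit _), this]

/-- `γ(gh₍₁₎ ⊗ S(h₍₂₎)k) = γ'(g₍₁₎ ⊗ h₍₁₎) γ(h₍₂₎ ⊗ S(h₍₃₎)k₍₁₎) γ(g₍₂₎ ⊗ k₍₂₎)`. -/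
theorem _root_.IsCocycle.map_mulLeft_mulRight_translation
    (hco : IsCocycle R H (mulH R H) γ γ') (g h k : H) :
    γ (map (mulLeft R g) (mulRight R k) (translation R h)) =
      ∑ i ∈ (ℛ R g).index, ∑ j ∈ (ℛ R h).index, γ' ((ℛ R g).left i ⊗ₜ (ℛ R h).left j) *
        ∑ l ∈ (ℛ R k).index,
          γ ((mulRight R ((ℛ R k).left l)).lTensor H (translation R ((ℛ R h).right j))) *
            γ ((ℛ R g).right i ⊗ₜ (ℛ R k).right l) := by
  have expand (a m : H) : γ ((g * a) ⊗ₜ m) =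
      ∑ i ∈ (ℛ R g).index, ∑ p ∈ (ℛ R a).index, γ' ((ℛ R g).left i ⊗ₜ (ℛ R a).left p) *
        (toConv γ * toConv ((γ ∘ₗ TensorProduct.mk R H H ((ℛ R g).right i)) ∘ₗ
          LinearMap.mul' R H)) ((ℛ R a).right p ⊗ₜ m) := by
    have : γ ((g * a) ⊗ₜ m) =
        (toConv γ' * (toConv γ * toConv ((γ ∘ₗ (TensorProduct.mk R H H).flip m) ∘ₗ
          LinearMap.mul' R H))) (g ⊗ₜ a) := by
      rw [← mul_assoc, hco.inv_mul, one_mul]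
      simp
    rw [this, ((ℛ R g).tmul (ℛ R a)).convMul_apply]
    simp only [← hco.convMul_tmul]
    simp [Finset.sum_product, -LinearMap.convMul_apply]
  have key (i : H × H) := sum_coassoc (LinearMap.mul' R R ∘ₗ
    map (γ' ∘ₗ TensorProduct.mk R H H ((ℛ R g).left i))
      ((toConv γ * toConv ((γ ∘ₗ TensorProduct.mk R H H ((ℛ R g).right i)) ∘ₗ
          LinearMap.mul' R H)).ofConv ∘ₗ (mulRight R k).lTensor H ∘ₗ (antipode R).lTensor H)) h
  simp only [LinearMap.comp_apply, map_tmul, LinearMap.mul'_apply, lTensor_tmul,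
    TensorProduct.mk_apply, mulRight_apply] at key
  conv_lhs => rw [translation_apply]
  simp only [map_sum, map_tmul, mulRight_apply, mulLeft_apply, expand]
  rw [Finset.sum_comm]
  refine Finset.sum_congr rfl fun i _ => (key i).trans ?_
  refine Finset.sum_congr rfl fun j _ => ?_
  rw [← Finset.mul_sum]
  congr 1
  have := convMul_comp_mul_lTensor_translation γ
    (γ ∘ₗ TensorProduct.mk R H H ((ℛ R g).right i)) ((ℛ R h).right j) k
  conv_lhs at this => rw [translation_apply]
  simpa only [map_sum, lTensor_tmul, mulRight_apply, LinearMap.comp_apply,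
    TensorProduct.mk_apply] using this

theorem convOn_comulT (f g : H ⊗[R] (H ⊗[R] H) →ₗ[R] R) :
    convOn R (comulT R H) f g = (toConv f * toConv g).ofConv := rfl

theorem convMul_left_factor_apply (f : H ⊗[R] H →ₗ[R] R)
    (Z : WithConv (H ⊗[R] (H ⊗[R] H) →ₗ[R] R)) (g h k : H) :
    (toConv (LinearMap.mul' R R ∘ₗ map f (counit (R := R) (A := H)) ∘ₗ
        (TensorProduct.assoc R H H H).symm.toLinearMap) * Z) (g ⊗ₜ (h ⊗ₜ k)) =
      ∑ i ∈ (ℛ R g).index, ∑ j ∈ (ℛ R h).index, f ((ℛ R g).left i ⊗ₜ (ℛ R h).left j) *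
        Z ((ℛ R g).right i ⊗ₜ ((ℛ R h).right j ⊗ₜ k)) := by
  rw [((ℛ R g).tmul ((ℛ R h).tmul (ℛ R k))).convMul_apply]
  have hk (a b : H) :=
    sum_counit_mul (Z.ofConv ∘ₗ TensorProduct.mk R H (H ⊗[R] H) a ∘ₗ TensorProduct.mk R H H b) k
  simp only [LinearMap.comp_apply, TensorProduct.mk_apply] at hk
  simp [Finset.sum_product, mul_assoc, ← Finset.mul_sum, hk]

theorem convMul_right_factor_apply (f : H ⊗[R] H →ₗ[R] R) (y : H ⊗[R] H →ₗ[R] R)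
    (Q : WithConv (H ⊗[R] (H ⊗[R] H) →ₗ[R] R))
    (hQ : ∀ g h k, Q (g ⊗ₜ (h ⊗ₜ k)) = counit (R := R) g * y (h ⊗ₜ k)) (g h k : H) :
    (Q * toConv (f ∘ₗ map LinearMap.id ((TensorProduct.lid R H).toLinearMap ∘ₗ
        map (counit (R := R) (A := H)) LinearMap.id))) (g ⊗ₜ (h ⊗ₜ k)) =
      ∑ l ∈ (ℛ R k).index, y (h ⊗ₜ (ℛ R k).left l) * f (g ⊗ₜ (ℛ R k).right l) := by
  rw [((ℛ R g).tmul ((ℛ R h).tmul (ℛ R k))).convMul_apply]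
  have hg (c : H) := sum_counit_mul (f ∘ₗ (TensorProduct.mk R H H).flip c) g
  have hh (c : H) := sum_mul_counit (y ∘ₗ (TensorProduct.mk R H H).flip c) h
  simp only [LinearMap.comp_apply, TensorProduct.mk_apply, LinearMap.flip_apply] at hg hh
  simp only [Coalgebra.Repr.tmul_index, Coalgebra.Repr.tmul_left, Coalgebra.Repr.tmul_right,
    Finset.sum_product, hQ, LinearMap.comp_apply, map_tmul, LinearEquiv.coe_coe,
    LinearMap.id_apply, TensorProduct.lid_tmul, tmul_smul, map_smul, smul_eq_mul,
    ← hg, ← hh, Finset.sum_mul_sum]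
  rw [Finset.sum_comm]
  conv_rhs => rw [Finset.sum_comm]
  refine Finset.sum_congr rfl fun j _ => ?_
  rw [Finset.sum_comm]
  refine Finset.sum_congr rfl fun l _ => Finset.sum_congr rfl fun i _ => ?_
  ring

theorem _root_.IsCocycle.convMul_middle_factors_apply (hco : IsCocycle R H (mulH R H) γ γ')
    (g h k : H) :
    (toConv (LinearMap.mul' R R ∘ₗ map (counit (R := R) (A := H))
          (LinearMap.mul' R R ∘ₗ map (uMap R H γ) (counit (R := R) (A := H)))) *
        toConv (LinearMap.mul' R R ∘ₗ map (counit (R := R) (A := H))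
          (γ' ∘ₗ map (Sa R H) LinearMap.id))) (g ⊗ₜ (h ⊗ₜ k)) =
      counit (R := R) g * γ ((mulRight R k).lTensor H (translation R h)) := by
  rw [((ℛ R g).tmul ((ℛ R h).tmul (ℛ R k))).convMul_apply, hco.lTensor_mulRight_translation]
  have hg := sum_counit_mul (counit (R := R)) g
  have hk (a : H) := sum_counit_mul (γ' ∘ₗ TensorProduct.mk R H H a) k
  simp only [LinearMap.comp_apply, TensorProduct.mk_apply] at hk
  have hu (a : H) : uMap R H γ a = γ (translation R a) := rfl
  simp only [Coalgebra.Repr.tmul_index, Coalgebra.Repr.tmul_left, Coalgebra.Repr.tmul_right,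
    Finset.sum_product, LinearMap.comp_apply, map_tmul, LinearMap.mul'_apply,
    LinearMap.id_apply, hu, ← hg, ← hk]
  rw [Finset.sum_mul]
  simp only [Finset.mul_sum]
  refine Finset.sum_congr rfl fun i _ => Finset.sum_congr rfl fun j _ =>
    Finset.sum_congr rfl fun l _ => ?_
  ring

end Cocycle

end HopfAlgebra

open HopfAlgebra WithConv

/-- `γ(g h₍₁₎ ⊗ S(h₍₂₎)k)
  = γ̄(g₍₁₎⊗h₍₁₎) u_γ(h₍₂₎) γ̄(S(h₍₃₎)⊗k₍₁₎) γ(g₍₂₎⊗k₍₂₎)`,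
stated as an equality of linear functionals on `H ⊗ (H ⊗ H)` (legs `g ⊗ (h ⊗ k)`);
the right-hand side is the convolution product of the four factors. -/
theorem cocycle_identity (R H : Type*) [CommRing R] [Ring H] [HopfAlgebra R H]
    (γ γ' : H ⊗[R] H →ₗ[R] R) (hco : IsCocycle R H (mulH R H) γ γ') :
    (γ ∘ₗ map (mulH R H) (mulH R H ∘ₗ map (Sa R H) LinearMap.id)
        ∘ₗ (TensorProduct.assoc R H H (H ⊗[R] H)).symm.toLinearMap
        ∘ₗ map LinearMap.id ((TensorProduct.assoc R H H H).toLinearMap)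
        ∘ₗ map LinearMap.id (map (Coalgebra.comul (R := R)) LinearMap.id))
      = convOn R (comulT R H)
          (convOn R (comulT R H)
            (convOn R (comulT R H)
              (LinearMap.mul' R R ∘ₗ map γ' (Coalgebra.counit (R := R))
                ∘ₗ (TensorProduct.assoc R H H H).symm.toLinearMap)
              (LinearMap.mul' R R ∘ₗ map (Coalgebra.counit (R := R))
                (LinearMap.mul' R R ∘ₗ map (uMap R H γ) (Coalgebra.counit (R := R)))))
            (LinearMap.mul' R R ∘ₗ map (Coalgebra.counit (R := R))
              (γ' ∘ₗ map (Sa R H) LinearMap.id)))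
          (γ ∘ₗ map LinearMap.id
            ((TensorProduct.lid R H).toLinearMap
              ∘ₗ map (Coalgebra.counit (R := R)) LinearMap.id)) := by
  let y : H ⊗[R] H →ₗ[R] R := γ ∘ₗ map LinearMap.id (mulH R H) ∘ₗ
    (TensorProduct.assoc R H H H).toLinearMap ∘ₗ map (translation R) LinearMap.id
  have hy (h k : H) : y (h ⊗ₜ k) = γ ((mulRight R k).lTensor H (translation R h)) := by
    simp [y, translation_apply, sum_tmul]
  simp only [convOn_comulT, toConv_ofConv]
  have assoc (a b c d : WithConv (H ⊗[R] (H ⊗[R] H) →ₗ[R] R)) :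
      a * b * c * d = a * (b * c * d) := by simp only [mul_assoc]
  rw [assoc]
  ext g h k
  refine Eq.trans ?_ ((hco.map_mulLeft_mulRight_translation g h k).trans ?_)
  · rw [translation_apply]
    simp only [AlgebraTensorModule.curry_apply, TensorProduct.curry_apply,
      LinearMap.coe_restrictScalars, LinearMap.comp_apply, map_tmul, LinearMap.id_apply,
      ← (Coalgebra.Repr.arbitrary R h).eq]
    simp [sum_tmul, tmul_sum]
  · refine Eq.symm ((convMul_left_factor_apply _ _ g h k).trans ?_)
    refine Finset.sum_congr rfl fun i _ => Finset.sum_congr rfl fun j _ => ?_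
    refine congrArg _ ((convMul_right_factor_apply γ y _ (fun a b c =>
      (hco.convMul_middle_factors_apply a b c).trans (by rw [hy])) _ _ k).trans ?_)
    simp only [hy]
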